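/- Fix integers 0 < d < n and set r = d*(n−d). Let γ be a cylindrical growth diagram and j ∈ ℤ. For an integer k with j−r+2 ≤ k ≤ j, say that NE holds at k if the unique cell of γ(k,j+2) \ γ(k,j+1) has strictly larger second coordinate (column index) than the unique cell of γ(k,j+1) \ γ(k,j). If NE holds at some k₀ with j−r+2 ≤ k₀ ≤ j, then NE holds at every k with j−r+2 ≤ k ≤ j. -/

import Mathlib

/-- `ν` is obtained from `μ` by adding one box. -/
def AddBox (μ ν : YoungDiagram) : Prop := μ ≤ ν ∧ ν.card = μ.card + 1

/-- Two cells of `ℕ × ℕ` are adjacent: `|a−a'| + |b−b'| = 1`. -/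
def CellAdj (c c' : ℕ × ℕ) : Prop :=
  |(c.1 : ℤ) - (c'.1 : ℤ)| + |(c.2 : ℤ) - (c'.2 : ℤ)| = 1

/-- `μ ∈ Λ(d,n)`: every cell `(i,j)` of `μ` has `i < d` and `j < n−d`. -/
def InLambda (d n : ℕ) (μ : YoungDiagram) : Prop :=
  ∀ c ∈ μ.cells, c.1 < d ∧ c.2 < n - d

/-- The full `d × m` rectangular Young diagram. -/
def rectYD (d m : ℕ) : YoungDiagram where
  cells := Finset.range d ×ˢ Finset.range m
  isLowerSet := by
    intro a b hba ha
    simp only [Finset.coe_product, Set.mem_prod, Finset.mem_coe, Finset.mem_range] at ha ⊢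
    exact ⟨lt_of_le_of_lt hba.1 ha.1, lt_of_le_of_lt hba.2 ha.2⟩

/-- A cylindrical growth diagram for the parameters `d < n`, with `r = d*(n−d)`:
a map `γ` on `𝕀 = {(i,j) : i ≤ j ≤ i + r}` (normalized to `⊥` off `𝕀`) valued in
`Λ(d,n)`, such that `γ i j` has `j − i` cells, `γ i (j+1)` and `γ (i−1) j` are
obtained from `γ i j` by adding one box, and whenever the two cells of
`γ (i−1) (j+1) \ γ i j` are nonadjacent, `γ i (j+1) ≠ γ (i−1) j`. -/
structure CGD (d n : ℕ) where
  γ : ℤ → ℤ → YoungDiagram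
  junk : ∀ i j : ℤ, ¬ (i ≤ j ∧ j ≤ i + ((d * (n - d) : ℕ) : ℤ)) → γ i j = ⊥
  lambda : ∀ i j : ℤ, i ≤ j → j ≤ i + ((d * (n - d) : ℕ) : ℤ) → InLambda d n (γ i j)
  card_eq : ∀ i j : ℤ, i ≤ j → j ≤ i + ((d * (n - d) : ℕ) : ℤ) →
    ((γ i j).card : ℤ) = j - i
  grow_right : ∀ i j : ℤ, i ≤ j → j + 1 ≤ i + ((d * (n - d) : ℕ) : ℤ) →
    AddBox (γ i j) (γ i (j + 1))
  grow_up : ∀ i j : ℤ, i ≤ j → j ≤ (i - 1) + ((d * (n - d) : ℕ) : ℤ) →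
    AddBox (γ i j) (γ (i - 1) j)
  nonadj : ∀ i j : ℤ, i ≤ j → j + 1 ≤ (i - 1) + ((d * (n - d) : ℕ) : ℤ) →
    (∃ c₁ ∈ (γ (i - 1) (j + 1)).cells \ (γ i j).cells,
      ∃ c₂ ∈ (γ (i - 1) (j + 1)).cells \ (γ i j).cells, c₁ ≠ c₂ ∧ ¬ CellAdj c₁ c₂) →
    γ i (j + 1) ≠ γ (i - 1) j

/-- `ν` is `μ` together with the single new cell `c`. -/
def AddsCell (μ : YoungDiagram) (c : ℕ × ℕ) (ν : YoungDiagram) : Prop :=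
  c ∉ μ ∧ ∀ y, y ∈ ν ↔ y = c ∨ y ∈ μ

theorem AddBox.exists_addsCell {μ ν : YoungDiagram} (h : AddBox μ ν) : ∃ c, AddsCell μ c ν := by
  obtain ⟨hle, hcard⟩ := h
  obtain ⟨c, hc, hins⟩ := Finset.covBy_iff_exists_insert.mp
    (Finset.covBy_iff_card_sdiff_eq_one.mpr ⟨hle, by
      rw [Finset.card_sdiff_of_subset hle]
      change ν.card - μ.card = 1
      omega⟩)
  refine ⟨c, by simpa using hc, fun y => ?_⟩
  rw [← YoungDiagram.mem_cells, ← hins, Finset.mem_insert, YoungDiagram.mem_cells]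

namespace AddsCell

variable {μ ν : YoungDiagram} {c : ℕ × ℕ}

theorem transpose (h : AddsCell μ c ν) : AddsCell μ.transpose c.swap ν.transpose := by
  refine ⟨by simpa using h.1, fun y => ?_⟩
  rw [YoungDiagram.mem_transpose, YoungDiagram.mem_transpose, h.2, ← Prod.swap_inj,
    Prod.swap_swap]

theorem mem_sdiff_iff (h : AddsCell μ c ν) (y : ℕ × ℕ) : y ∈ ν.cells \ μ.cells ↔ y = c := by
  have h1 := h.1
  rw [Finset.mem_sdiff, YoungDiagram.mem_cells, YoungDiagram.mem_cells, h.2]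
  grind

end AddsCell

/-- The local rule of a growth diagram: `a`, `x'` are the cells added along one side of a square
and `x`, `b` those added along the other. Either the two cells are added in opposite orders, or
the cells are adjacent and the order is forced. -/
def LocalRule (a x x' b : ℕ × ℕ) : Prop :=
  (b = a ∧ x' = x) ∨ (x = a ∧ b = x' ∧ (x' = (a.1 + 1, a.2) ∨ x' = (a.1, a.2 + 1)))

theorem LocalRule.swap {a x x' b : ℕ × ℕ} (h : LocalRule a x x' b) :
    LocalRule a.swap x.swap x'.swap b.swap := by
  rcases h with ⟨rfl, rfl⟩ | ⟨rfl, rfl, rfl | rfl⟩ <;> simp [LocalRule]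

theorem LocalRule.of_addsCell {μ μ' ν ν' : YoungDiagram} {a x x' b : ℕ × ℕ}
    (ha : AddsCell μ a μ') (hx : AddsCell μ x ν) (hx' : AddsCell μ' x' ν') (hb : AddsCell ν b ν')
    (hne : (∃ c₁ ∈ ν'.cells \ μ.cells, ∃ c₂ ∈ ν'.cells \ μ.cells, c₁ ≠ c₂ ∧ ¬ CellAdj c₁ c₂) →
      μ' ≠ ν) : LocalRule a x x' b := by
  obtain ⟨ha0, ha⟩ := ha
  obtain ⟨hx0, hx⟩ := hx
  obtain ⟨hx0', hx'⟩ := hx'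
  obtain ⟨hb0, hb⟩ := hb
  have hxa : a ≠ x' := by grind
  by_cases h : x = a
  · subst h
    have hμν : μ' = ν := by
      ext y
      rw [YoungDiagram.mem_cells, YoungDiagram.mem_cells, ha, hx]
    have hadj : CellAdj x x' := by
      by_contra hn
      refine hne ⟨x, ?_, x', ?_, hxa, hn⟩ hμν <;>
        rw [Finset.mem_sdiff, YoungDiagram.mem_cells, YoungDiagram.mem_cells] <;> grind
    have hle : ¬ (x'.1 ≤ x.1 ∧ x'.2 ≤ x.2) := fun hle =>
      hx0' (μ'.up_left_mem hle.1 hle.2 ((ha x).2 (Or.inl rfl)))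
    refine Or.inr ⟨rfl, by grind, ?_⟩
    obtain ⟨p, q⟩ := x
    obtain ⟨p', q'⟩ := x'
    simp only [CellAdj, Prod.mk.injEq] at *
    grind
  · exact Or.inl (by grind)

section Slide

variable {A₀ A₁ A₂ B₀ B₁ B₂ : YoungDiagram} {a₁ a₂ b₁ b₂ x₀ x₁ x₂ : ℕ × ℕ}

/-- Sliding a pair of consecutive added cells preserves the column order. -/
theorem snd_lt_of_localRule
    (ha₁ : AddsCell A₀ a₁ A₁) (ha₂ : AddsCell A₁ a₂ A₂)
    (hb₁ : AddsCell B₀ b₁ B₁) (hb₂ : AddsCell B₁ b₂ B₂) (hx₁ : AddsCell A₁ x₁ B₁)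
    (h₁ : LocalRule a₁ x₀ x₁ b₁) (h₂ : LocalRule a₂ x₁ x₂ b₂) (h : a₁.2 < a₂.2) :
    b₁.2 < b₂.2 := by
  rcases h₁ with ⟨rfl, rfl⟩ | ⟨rfl, rfl, h₁⟩
  · rcases h₂ with ⟨rfl, rfl⟩ | ⟨rfl, rfl, rfl | rfl⟩ <;> grind
  rcases h₂ with ⟨rfl, rfl⟩ | ⟨rfl, rfl, h₂⟩
  · rcases h₁ with rfl | rfl
    · exact h
    refine lt_of_le_of_ne h fun heq => ?_
    have hrow : b₂.1 ≤ x₀.1 := by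
      by_contra! hrow
      have hmem : (x₀.1, b₂.2) ∈ A₂ :=
        A₂.up_left_mem hrow.le le_rfl ((ha₂.2 b₂).2 (Or.inl rfl))
      rw [ha₂.2] at hmem
      have hA₁ : (x₀.1, b₂.2) ∈ A₁ := by grind
      exact hx₁.1 (by simpa [← heq] using hA₁)
    exact hb₂.1 (B₁.up_left_mem hrow heq.symm.le ((hb₁.2 _).2 (Or.inl rfl)))
  · rcases h₁ with rfl | rfl
    · grind
    rcases h₂ with rfl | rfl
    · exfalso
      have hmem : (x₀.1 + 1, x₀.2) ∈ B₂ :=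
        B₂.up_left_mem le_rfl (Nat.le_succ _) ((hb₂.2 _).2 (Or.inl rfl))
      rw [hb₂.2, hx₁.2, ha₁.2] at hmem
      have hA₀ : (x₀.1 + 1, x₀.2) ∈ A₀ := by
        rcases hmem with h | h | h | h
        · simp at h
        · simp at h
        · simp [Prod.ext_iff] at h
        · exact h
      exact ha₁.1 (A₀.up_left_mem (Nat.le_succ _) le_rfl hA₀)
    · simp

/-- Of two consecutive added cells, exactly one coordinate increases strictly. -/
theorem AddsCell.snd_lt_iff (ha₁ : AddsCell A₀ a₁ A₁) (ha₂ : AddsCell A₁ a₂ A₂) :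
    a₁.2 < a₂.2 ↔ ¬ a₁.1 < a₂.1 := by
  constructor
  · intro hcol hrow
    have hmem : (a₁.1, a₂.2) ∈ A₂ := A₂.up_left_mem hrow.le le_rfl ((ha₂.2 a₂).2 (Or.inl rfl))
    rw [ha₂.2, ha₁.2] at hmem
    have hA₀ : (a₁.1, a₂.2) ∈ A₀ := by grind
    exact ha₁.1 (A₀.up_left_mem le_rfl hcol.le hA₀)
  · intro hrow
    by_contra! hcol
    exact ha₂.1 (A₁.up_left_mem (not_lt.mp hrow) hcol ((ha₁.2 a₁).2 (Or.inl rfl)))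

theorem snd_lt_iff_of_localRule
    (ha₁ : AddsCell A₀ a₁ A₁) (ha₂ : AddsCell A₁ a₂ A₂)
    (hb₁ : AddsCell B₀ b₁ B₁) (hb₂ : AddsCell B₁ b₂ B₂) (hx₁ : AddsCell A₁ x₁ B₁)
    (h₁ : LocalRule a₁ x₀ x₁ b₁) (h₂ : LocalRule a₂ x₁ x₂ b₂) :
    a₁.2 < a₂.2 ↔ b₁.2 < b₂.2 := by
  refine ⟨snd_lt_of_localRule ha₁ ha₂ hb₁ hb₂ hx₁ h₁ h₂, ?_⟩
  rw [ha₁.snd_lt_iff ha₂, hb₁.snd_lt_iff hb₂]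
  exact mt (snd_lt_of_localRule ha₁.transpose ha₂.transpose hb₁.transpose hb₂.transpose
    hx₁.transpose h₁.swap h₂.swap)

end Slide

namespace CGD

variable {d n : ℕ} (g : CGD d n) (j : ℤ)

/-- The cell added in column `j + 2` of row `k` lies in a column strictly to the right of that of
the cell added in column `j + 1`. -/
def IsNE (k : ℤ) : Prop :=
  ∃ c₁ ∈ (g.γ k (j + 1)).cells \ (g.γ k j).cells,
    ∃ c₂ ∈ (g.γ k (j + 2)).cells \ (g.γ k (j + 1)).cells, c₁.2 < c₂.2

theorem isNE_iff_sub_one {k : ℤ} (hl : j - ((d * (n - d) : ℕ) : ℤ) + 2 ≤ k - 1) (hr : k ≤ j) :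
    g.IsNE j k ↔ g.IsNE j (k - 1) := by
  have hj : j + 1 + 1 = j + 2 := by ring
  obtain ⟨a₁, ha₁⟩ := (g.grow_right k j hr (by omega)).exists_addsCell
  obtain ⟨a₂, ha₂⟩ := (g.grow_right k (j + 1) (by omega) (by omega)).exists_addsCell
  obtain ⟨b₁, hb₁⟩ := (g.grow_right (k - 1) j (by omega) (by omega)).exists_addsCell
  obtain ⟨b₂, hb₂⟩ := (g.grow_right (k - 1) (j + 1) (by omega) (by omega)).exists_addsCell
  obtain ⟨x₀, hx₀⟩ := (g.grow_up k j hr (by omega)).exists_addsCell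
  obtain ⟨x₁, hx₁⟩ := (g.grow_up k (j + 1) (by omega) (by omega)).exists_addsCell
  obtain ⟨x₂, hx₂⟩ := (g.grow_up k (j + 1 + 1) (by omega) (by omega)).exists_addsCell
  have h₁ := LocalRule.of_addsCell ha₁ hx₀ hx₁ hb₁ (g.nonadj k j hr (by omega))
  have h₂ := LocalRule.of_addsCell ha₂ hx₁ hx₂ hb₂ (g.nonadj k (j + 1) (by omega) (by omega))
  have key := snd_lt_iff_of_localRule ha₁ ha₂ hb₁ hb₂ hx₁ h₁ h₂
  rw [hj] at ha₂ hb₂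
  simpa [IsNE, -Finset.mem_sdiff, ha₁.mem_sdiff_iff, ha₂.mem_sdiff_iff, hb₁.mem_sdiff_iff,
    hb₂.mem_sdiff_iff] using key

theorem isNE_iff_self {k : ℤ} (hl : j - ((d * (n - d) : ℕ) : ℤ) + 2 ≤ k) (hr : k ≤ j) :
    g.IsNE j k ↔ g.IsNE j j := by
  induction k, hr using Int.leInductionDown with
  | base => rfl
  | pred k hk ih => rw [← g.isNE_iff_sub_one j hl hk, ih (by omega)]

end CGD

/-- **Propagation of the "northeast" condition along a column pair.** Let `g` be a
cylindrical growth diagram and `j : ℤ`. Say NE holds at `k` (for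
`j − r + 2 ≤ k ≤ j`) if the cell of `γ(k,j+2) \ γ(k,j+1)` has strictly larger
column index than the cell of `γ(k,j+1) \ γ(k,j)`. If NE holds at some `k₀` in
range, then NE holds at every `k` in range. -/
theorem stmt7 (d n : ℕ) (hd : 0 < d) (hdn : d < n) (g : CGD d n) (j : ℤ)
    (k₀ : ℤ) (hk₀l : j - ((d * (n - d) : ℕ) : ℤ) + 2 ≤ k₀) (hk₀r : k₀ ≤ j)
    (hNE : ∃ c₁ ∈ (g.γ k₀ (j + 1)).cells \ (g.γ k₀ j).cells,
      ∃ c₂ ∈ (g.γ k₀ (j + 2)).cells \ (g.γ k₀ (j + 1)).cells, c₁.2 < c₂.2) :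
    ∀ k : ℤ, j - ((d * (n - d) : ℕ) : ℤ) + 2 ≤ k → k ≤ j →
      ∃ c₁ ∈ (g.γ k (j + 1)).cells \ (g.γ k j).cells,
        ∃ c₂ ∈ (g.γ k (j + 2)).cells \ (g.γ k (j + 1)).cells, c₁.2 < c₂.2 := by
  exact fun k hkl hkr =>
    (g.isNE_iff_self j hkl hkr).2 ((g.isNE_iff_self j hk₀l hk₀r).1 hNE)
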